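/- Let W be an (α,m,N)-source over {0,1}^n and let E : {0,1}^m × {0,1}^r → {0,1}^ν be an average case (m,α,ν,ε)-extractor with the additional property that E(Ũ, Z) is uniform over {0,1}^ν whenever Ũ is uniform over {0,1}^m and Z is an independent uniform seed. Let Z be uniform over {0,1}^r, let A_1,…,A_ℓ be independent uniformly random subsets of {1,…,n} of cardinality m, all independent of W, let S be uniform over {0,1}^{ν−t} independent of everything else, and set p_i = E(W[A_i], Z) ⊕ (0^t | S) for i = 1,…,ℓ, where 0^t | S denotes the ν-bit string obtained by prefixing S with t zero bits. If ℓ·m < N, then Δ((S, p_1,…,p_ℓ, Z, A_1,…,A_ℓ); (U, p_1,…,p_ℓ, Z, A_1,…,A_ℓ)) ≤ 2ℓ·ε, where U is uniform over {0,1}^{ν−t} independent of (p_1,…,p_ℓ, Z, A_1,…,A_ℓ). -/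

import Mathlib

noncomputable section

/-- Statistical distance between two PMFs on a finite type. -/
def statDist {T : Type*} [Fintype T] (p q : PMF T) : ℝ :=
  (1 / 2) * ∑ v : T, |(p v).toReal - (q v).toReal|

/-- Independent product of two PMFs. -/
def pmfProd {α β : Type*} (p : PMF α) (q : PMF β) : PMF (α × β) :=
  p.bind fun a => q.map fun b => (a, b)

/-- Average conditional min-entropy of a joint distribution on X × Y. -/
def avgCondMinEntropy {X Y : Type*} [Fintype X] [Fintype Y] (μ : PMF (X × Y)) : ℝ :=
  - Real.logb 2 (∑ y : Y, ⨆ x : X, (μ (x, y)).toReal)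

/-- Average case `(·,α,·,ε)`-extractor. -/
def IsAvgExtractor {𝒳 𝒮 𝒴 : Type*} [Fintype 𝒳] [Fintype 𝒮] [Nonempty 𝒮]
    [Fintype 𝒴] [Nonempty 𝒴] (E : 𝒳 → 𝒮 → 𝒴) (α ε : ℝ) : Prop :=
  ∀ (Aux : Type) [Fintype Aux], ∀ μ : PMF (𝒳 × Aux),
    α ≤ avgCondMinEntropy μ →
    statDist
      ((pmfProd μ (PMF.uniformOfFintype 𝒮)).map fun z => (E z.1.1 z.2, z.1.2, z.2))
      ((pmfProd (pmfProd μ (PMF.uniformOfFintype 𝒮)) (PMF.uniformOfFintype 𝒴)).map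
        fun z => (z.2, z.1.1.2, z.1.2))
      ≤ ε

lemma mSub_nonempty {α : Type*} [Fintype α] [DecidableEq α] {m : ℕ}
    (h : m ≤ Fintype.card α) : Nonempty {A : Finset α // A.card = m} := by
  obtain ⟨t, -, ht⟩ := Finset.exists_subset_card_eq
    (show m ≤ (Finset.univ : Finset α).card by simpa using h)
  exact ⟨⟨t, ht⟩⟩

/-- `k` independent uniformly random `m`-subsets. -/
def uniformSubsets (α : Type*) [Fintype α] [DecidableEq α] (m k : ℕ)
    (h : m ≤ Fintype.card α) : PMF (Fin k → {A : Finset α // A.card = m}) :=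
  haveI : Nonempty {A : Finset α // A.card = m} := mSub_nonempty h
  PMF.uniformOfFintype _

/-- A uniformly random `m`-subset. -/
def uniformSubset (α : Type*) [Fintype α] [DecidableEq α] (m : ℕ)
    (h : m ≤ Fintype.card α) : PMF {A : Finset α // A.card = m} :=
  haveI : Nonempty {A : Finset α // A.card = m} := mSub_nonempty h
  PMF.uniformOfFintype _

/-- The masked substring `w[A]`. -/
def subsample {α : Type*} [DecidableEq α] (w : α → Bool) (A : Finset α) :
    α → Option Bool :=
  fun i => if i ∈ A then some (w i) else none

/-- The substring of `w` indexed by the `m`-subset `A` (in increasing order of positions). -/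
def sampleBits {n m : ℕ} (w : Fin n → Bool) (A : {s : Finset (Fin n) // s.card = m}) :
    Fin m → Bool :=
  fun i => w (A.1.orderIsoOfFin A.2 i).1

/-- `(α,m,N)`-source over `{0,1}^n`. -/
def IsAlphaSource (n : ℕ) (Wd : PMF (Fin n → Bool)) (α : ℝ) (m N : ℕ)
    (hm : m ≤ n) (hN : N ≤ n) : Prop :=
  α ≤ avgCondMinEntropy (do
    let w ← Wd
    let A ← uniformSubset (Fin n) m (by simpa using hm)
    let B ← uniformSubset (Fin n) N (by simpa using hN)
    return (subsample w A.1, (subsample w B.1, A, B)))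

theorem statDist_bind_le {T T' : Type*} [Fintype T] [Fintype T'] (p q : PMF T) (κ : T → PMF T') :
    statDist (p.bind κ) (q.bind κ) ≤ statDist p q := by
  have key (p : PMF T) (v : T') : (p.bind κ v).toReal = ∑ a, (p a).toReal * (κ a v).toReal := by
    rw [PMF.bind_apply, tsum_fintype, ENNReal.toReal_sum
      fun a _ => ENNReal.mul_ne_top (p.apply_ne_top a) ((κ a).apply_ne_top v)]
    simp
  have hκ (a : T) : ∑ v, (κ a v).toReal = 1 := by
    rw [← ENNReal.toReal_sum fun v _ => (κ a).apply_ne_top v, ← tsum_fintype (L := .unconditional T'),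
      (κ a).tsum_coe, ENNReal.toReal_one]
  unfold statDist
  gcongr
  calc ∑ v, |(p.bind κ v).toReal - (q.bind κ v).toReal|
      = ∑ v, |∑ a, ((p a).toReal - (q a).toReal) * (κ a v).toReal| := by
        simp only [key, ← Finset.sum_sub_distrib, sub_mul]
    _ ≤ ∑ v, ∑ a, |(p a).toReal - (q a).toReal| * (κ a v).toReal := by
        gcongr with v
        refine (Finset.abs_sum_le_sum_abs _ _).trans_eq (Finset.sum_congr rfl fun a _ => ?_)
        rw [abs_mul, abs_of_nonneg ENNReal.toReal_nonneg]
    _ = ∑ a, |(p a).toReal - (q a).toReal| := by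
        rw [Finset.sum_comm]
        simp only [← Finset.mul_sum, hκ, mul_one]

theorem statDist_triangle {T : Type*} [Fintype T] (p q r : PMF T) :
    statDist p r ≤ statDist p q + statDist q r := by
  unfold statDist
  rw [← mul_add, ← Finset.sum_add_distrib]
  gcongr
  exact abs_sub_le _ _ _

theorem statDist_comm {T : Type*} [Fintype T] (p q : PMF T) : statDist p q = statDist q p := by
  simp only [statDist, abs_sub_comm]

theorem statDist_self {T : Type*} [Fintype T] (p : PMF T) : statDist p p = 0 := by
  simp [statDist]

theorem natCast_card_ne_zero (α : Type*) [Fintype α] [Nonempty α] :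
    (Fintype.card α : ENNReal) ≠ 0 :=
  Nat.cast_ne_zero.mpr Fintype.card_ne_zero

theorem uniformOfFintype_map_equiv {α β : Type*} [Fintype α] [Nonempty α] [Fintype β] [Nonempty β]
    (e : α ≃ β) : (PMF.uniformOfFintype α).map e = PMF.uniformOfFintype β := by
  classical
  ext b
  rw [PMF.map_apply, tsum_eq_single (e.symm b)]
  · simp [Fintype.card_congr e]
  · intro a ha
    rw [if_neg]
    rintro rfl
    simp at ha

theorem uniformOfFintype_bind_update {ι V γ : Type*} [Fintype ι] [DecidableEq ι] [Fintype V]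
    [Nonempty V] (i : ι) (F : (ι → V) → PMF γ) :
    ((PMF.uniformOfFintype V).bind fun u =>
      (PMF.uniformOfFintype (ι → V)).bind fun f => F (Function.update f i u)) =
      (PMF.uniformOfFintype (ι → V)).bind F := by
  classical
  ext c
  simp only [PMF.bind_apply, tsum_fintype, PMF.uniformOfFintype_apply, ← Finset.mul_sum]
  have hswap : ∑ u : V, ∑ f : ι → V, F (Function.update f i u) c
      = ∑ u : V, ∑ f : ι → V, F f c := by
    rw [← Fintype.sum_prod_type', ← Fintype.sum_prod_type']
    let e : V × (ι → V) → V × (ι → V) := fun z => (z.2 i, Function.update z.2 i z.1)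
    have he : Function.Involutive e := fun z => by simp [e]
    exact Equiv.sum_comp he.toPerm (fun z : V × (ι → V) => F z.2 c)
  rw [hswap, Finset.sum_const, Finset.card_univ, nsmul_eq_mul, mul_left_comm, ← mul_assoc _⁻¹ _ (∑ _, _),
    ENNReal.inv_mul_cancel (by simp) (by simp), one_mul]

theorem exists_perm_map_eq {α : Type*} [Fintype α] [DecidableEq α] {B C : Finset α}
    (h : B.card = C.card) : ∃ π : Equiv.Perm α, B.map π.toEmbedding = C := by
  let e := Finset.equivOfCardEq h
  refine ⟨e.extendSubtype, Finset.eq_of_subset_of_card_le ?_ (by simp [h])⟩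
  intro x hx
  obtain ⟨b, hb, rfl⟩ := Finset.mem_map.mp hx
  exact e.extendSubtype_mem b hb

/-- The permutation of the `k`-subsets induced by a permutation of the points. -/
def subsetPerm {α : Type*} (k : ℕ) (π : Equiv.Perm α) :
    Equiv.Perm {s : Finset α // s.card = k} :=
  π.finsetCongr.subtypeEquiv fun s => by simp

theorem card_smul_sum_perm {α : Type*} [Fintype α] [DecidableEq α] {N : ℕ}
    (F : Finset α → ENNReal) (B₀ : {s : Finset α // s.card = N}) :
    Fintype.card {s : Finset α // s.card = N} * ∑ π : Equiv.Perm α, F (B₀.1.map π.toEmbedding) =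
      Fintype.card (Equiv.Perm α) * ∑ B : {s : Finset α // s.card = N}, F B.1 := by
  have h1 (B : {s : Finset α // s.card = N}) :
      ∑ π : Equiv.Perm α, F (B₀.1.map π.toEmbedding) =
        ∑ π : Equiv.Perm α, F (B.1.map π.toEmbedding) := by
    obtain ⟨τ, hτ⟩ := exists_perm_map_eq (B₀.2.trans B.2.symm)
    rw [← hτ, ← Equiv.sum_comp (Equiv.mulRight τ)]
    refine Finset.sum_congr rfl fun π _ => ?_
    rw [Finset.map_map]
    rfl
  have h2 (π : Equiv.Perm α) :
      ∑ B : {s : Finset α // s.card = N}, F (B.1.map π.toEmbedding) =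
        ∑ B : {s : Finset α // s.card = N}, F B.1 :=
    Equiv.sum_comp (subsetPerm N π) (fun B => F B.1)
  calc _ = ∑ B : {s : Finset α // s.card = N},
        ∑ π : Equiv.Perm α, F (B.1.map π.toEmbedding) := by
        simp [← h1, Finset.sum_const]
    _ = _ := by
        rw [Finset.sum_comm]
        simp [h2, Finset.sum_const]

/-- The average of a monotone set function over unions of independent random `m`-subsets
is at most its average over random `N`-subsets, if these unions have at most `N` points. -/
theorem average_biUnion_le {α ι : Type*} [Fintype α] [DecidableEq α] [Fintype ι] [DecidableEq ι]
    {m N : ℕ} (hm : m ≤ Fintype.card α) (hN : N ≤ Fintype.card α)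
    (hι : Fintype.card ι * m ≤ N) {F : Finset α → ENNReal} (hF : Monotone F) :
    (Fintype.card (ι → {s : Finset α // s.card = m}) : ENNReal)⁻¹ *
        ∑ c : ι → {s : Finset α // s.card = m}, F (Finset.univ.biUnion fun j => (c j).1) ≤
      (Fintype.card {s : Finset α // s.card = N} : ENNReal)⁻¹ *
        ∑ B : {s : Finset α // s.card = N}, F B.1 := by
  have := mSub_nonempty hm
  have := mSub_nonempty hN
  set U : (ι → {s : Finset α // s.card = m}) → Finset α :=
    fun c => Finset.univ.biUnion fun j => (c j).1
  set KN := ∑ B : {s : Finset α // s.card = N}, F B.1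
  have hperm (π : Equiv.Perm α) : ∑ c, F ((U c).map π.toEmbedding) = ∑ c, F (U c) := by
    rw [← Equiv.sum_comp (Equiv.arrowCongr (Equiv.refl ι) (subsetPerm m π)) (fun c => F (U c))]
    refine Finset.sum_congr rfl fun c _ => congrArg F ?_
    ext x
    simp [U, subsetPerm]
  have hcard (c) : (U c).card ≤ N :=
    (Finset.card_biUnion_le.trans (by simp [(c _).2])).trans hι
  have hle (c) : (Fintype.card {s : Finset α // s.card = N} : ENNReal) *
      ∑ π : Equiv.Perm α, F ((U c).map π.toEmbedding) ≤ Fintype.card (Equiv.Perm α) * KN := by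
    obtain ⟨B, hB, -, hBN⟩ := Finset.exists_subsuperset_card_eq (Finset.subset_univ (U c))
      (hcard c) (by simpa using hN)
    rw [← card_smul_sum_perm F ⟨B, hBN⟩]
    gcongr with π
    exact hF (Finset.map_subset_map.mpr hB)
  have hsum : (Fintype.card (Equiv.Perm α) : ENNReal) *
      ((Fintype.card {s : Finset α // s.card = N} : ENNReal) * ∑ c, F (U c)) ≤
      (Fintype.card (Equiv.Perm α) : ENNReal) *
      ((Fintype.card (ι → {s : Finset α // s.card = m}) : ENNReal) * KN) := by
    calc _ = ∑ c, (Fintype.card {s : Finset α // s.card = N} : ENNReal) *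
        ∑ π : Equiv.Perm α, F ((U c).map π.toEmbedding) := by
          rw [← Finset.mul_sum, Finset.sum_comm]
          simp only [hperm, Finset.sum_const, Finset.card_univ, nsmul_eq_mul]
          ring
      _ ≤ ∑ c : ι → {s : Finset α // s.card = m}, Fintype.card (Equiv.Perm α) * KN :=
          Finset.sum_le_sum fun c _ => hle c
      _ = _ := by
          rw [Finset.sum_const, Finset.card_univ, nsmul_eq_mul]
          ring
  rw [ENNReal.mul_le_mul_iff_right (natCast_card_ne_zero _) (ENNReal.natCast_ne_top _)] at hsum
  rwa [ENNReal.inv_mul_le_iff (natCast_card_ne_zero _) (ENNReal.natCast_ne_top _), mul_left_comm,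
    ← ENNReal.mul_le_mul_iff_right (natCast_card_ne_zero {s : Finset α // s.card = N})
      (ENNReal.natCast_ne_top _),
    ENNReal.mul_inv_cancel_left (natCast_card_ne_zero _) (ENNReal.natCast_ne_top _)]

/-- The probability of guessing the first component of `μ` correctly from the second one. -/
def guessProb {X Y : Type*} [Fintype Y] (μ : PMF (X × Y)) : ENNReal :=
  ∑ y : Y, ⨆ x : X, μ (x, y)

theorem guessProb_ne_top {X Y : Type*} [Fintype Y] (μ : PMF (X × Y)) : guessProb μ ≠ ⊤ := by
  refine (ENNReal.sum_lt_top.mpr fun y _ => ?_).ne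
  exact (iSup_le fun x => μ.coe_le_one (x, y)).trans_lt ENNReal.one_lt_top

theorem guessProb_ne_zero {X Y : Type*} [Fintype Y] (μ : PMF (X × Y)) : guessProb μ ≠ 0 := by
  obtain ⟨⟨x, y⟩, h⟩ := μ.support_nonempty
  intro h0
  have h1 := Finset.sum_eq_zero_iff.mp h0 y (Finset.mem_univ y)
  exact h (le_antisymm (h1 ▸ le_iSup (fun x => μ (x, y)) x) bot_le)

theorem avgCondMinEntropy_eq {X Y : Type*} [Fintype X] [Fintype Y] (μ : PMF (X × Y)) :
    avgCondMinEntropy μ = -Real.logb 2 (guessProb μ).toReal := by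
  unfold avgCondMinEntropy guessProb
  rw [ENNReal.toReal_sum]
  · simp only [ENNReal.toReal_iSup fun x => μ.apply_ne_top _]
  · exact fun y _ => ((iSup_le fun x => μ.coe_le_one (x, y)).trans_lt ENNReal.one_lt_top).ne

theorem avgCondMinEntropy_le_of_guessProb_le {X Y X' Y' : Type*} [Fintype X] [Fintype Y]
    [Fintype X'] [Fintype Y'] {μ : PMF (X × Y)} {μ' : PMF (X' × Y')}
    (h : guessProb μ' ≤ guessProb μ) : avgCondMinEntropy μ ≤ avgCondMinEntropy μ' := by
  rw [avgCondMinEntropy_eq, avgCondMinEntropy_eq, neg_le_neg_iff]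
  exact Real.logb_le_logb_of_le one_lt_two
    (ENNReal.toReal_pos (guessProb_ne_zero _) (guessProb_ne_top _))
    (ENNReal.toReal_mono (guessProb_ne_top _) h)

/-- Guessing more from less information is harder. -/
theorem guessProb_map_le {Ω X X' K H : Type*} [Fintype K] [Fintype H] (p : PMF Ω)
    (f : Ω → X') (ψ : X' → X) (k : Ω → K) (φ : K → H) :
    guessProb (p.map fun ω => (f ω, φ (k ω))) ≤ guessProb (p.map fun ω => (ψ (f ω), k ω)) := by
  classical
  unfold guessProb
  rw [← Finset.sum_fiberwise Finset.univ φ]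
  refine Finset.sum_le_sum fun v _ => iSup_le fun x => ?_
  calc p.map (fun ω => (f ω, φ (k ω))) (x, v)
      ≤ ∑ u with φ u = v, p.map (fun ω => (ψ (f ω), k ω)) (ψ x, u) := by
        simp only [PMF.map_apply]
        rw [← Summable.tsum_finsetSum fun _ _ => ENNReal.summable]
        refine ENNReal.tsum_le_tsum fun ω => ?_
        split_ifs with h
        · obtain ⟨rfl, rfl⟩ := Prod.mk.inj h
          refine le_trans ?_ (Finset.single_le_sum (fun _ _ => bot_le)
            (Finset.mem_filter.mpr ⟨Finset.mem_univ (k ω), rfl⟩))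
          simp
        · exact bot_le
    _ ≤ _ := Finset.sum_le_sum fun u _ => le_iSup (fun x => (p.map _) (x, u)) (ψ x)

theorem guessProb_bind_public {Ω X K P : Type*} [Fintype K] [Fintype P] (q : PMF P) (p : PMF Ω)
    (f : P → Ω → X) (k : P → Ω → K) :
    guessProb (q.bind fun a => p.map fun ω => (f a ω, (k a ω, a))) =
      ∑ a, q a * guessProb (p.map fun ω => (f a ω, k a ω)) := by
  classical
  unfold guessProb
  rw [Fintype.sum_prod_type, Finset.sum_comm]
  refine Finset.sum_congr rfl fun a _ => ?_
  rw [Finset.mul_sum]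
  refine Finset.sum_congr rfl fun u _ => ?_
  rw [ENNReal.mul_iSup]
  refine iSup_congr fun x => ?_
  rw [PMF.bind_apply, tsum_fintype, Finset.sum_eq_single a]
  · simp [PMF.map_apply]
  · intro b _ hb
    simp [PMF.map_apply, Ne.symm hb]
  · simp

theorem pmfProd_apply {α β : Type*} (p : PMF α) (q : PMF β) (a : α) (b : β) :
    pmfProd p q (a, b) = p a * q b := by
  classical
  rw [pmfProd, PMF.bind_apply, tsum_eq_single a]
  · rw [PMF.map_apply, tsum_eq_single b] <;> simp +contextual [eq_comm]
  · intro c hc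
    simp [PMF.map_apply, Ne.symm hc]

theorem subsample_of_subset {α : Type*} [DecidableEq α] (w : α → Bool) {A B : Finset α}
    (h : A ⊆ B) : subsample w A = fun i => if i ∈ A then subsample w B i else none := by
  ext1 i
  by_cases hi : i ∈ A
  · simp [subsample, hi, h hi]
  · simp [subsample, hi]

theorem sampleBits_eq_of_subset {n m : ℕ} (w : Fin n → Bool)
    (A : {s : Finset (Fin n) // s.card = m}) {B : Finset (Fin n)} (h : A.1 ⊆ B) :
    sampleBits w A = fun i => (subsample w B (A.1.orderIsoOfFin A.2 i).1).getD false := by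
  ext1 i
  simp only [sampleBits, subsample, if_pos (h (A.1.orderIsoOfFin A.2 i).2), Option.getD_some]

theorem subsample_eq_sampleBits {n m : ℕ} (w : Fin n → Bool)
    (A : {s : Finset (Fin n) // s.card = m}) :
    subsample w A.1 = fun i => if h : i ∈ A.1 then
      some (sampleBits w A ((A.1.orderIsoOfFin A.2).symm ⟨i, h⟩)) else none := by
  ext1 i
  by_cases h : i ∈ A.1
  · simp [subsample, sampleBits, h]
  · simp [subsample, h]

theorem uniformSubset_apply {α : Type*} [Fintype α] [DecidableEq α] {m : ℕ}
    (h : m ≤ Fintype.card α) (A : {A : Finset α // A.card = m}) :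
    uniformSubset α m h A = (Fintype.card {A : Finset α // A.card = m} : ENNReal)⁻¹ :=
  haveI := mSub_nonempty h
  PMF.uniformOfFintype_apply A

theorem uniformSubsets_apply {α : Type*} [Fintype α] [DecidableEq α] {m k : ℕ}
    (h : m ≤ Fintype.card α) (A : Fin k → {A : Finset α // A.card = m}) :
    uniformSubsets α m k h A =
      (Fintype.card (Fin k → {A : Finset α // A.card = m}) : ENNReal)⁻¹ :=
  haveI := mSub_nonempty h
  PMF.uniformOfFintype_apply A

/-- The joint distribution of the `i`-th of `ℓ` random samples of a random string, and of the
other samples together with all index sets. -/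
def samplesDist {n ℓ : ℕ} (Wd : PMF (Fin n → Bool)) (m : ℕ) (hm : m ≤ Fintype.card (Fin n))
    (i : Fin ℓ) : PMF ((Fin m → Bool) × (({j : Fin ℓ // j ≠ i} → Fin m → Bool) ×
      (Fin ℓ → {A : Finset (Fin n) // A.card = m}))) :=
  (uniformSubsets (Fin n) m ℓ hm).bind fun A =>
    Wd.map fun w => (sampleBits w (A i), ((fun j => sampleBits w (A j)), A))

theorem le_avgCondMinEntropy_samplesDist {n m N ℓ : ℕ} {α : ℝ} (hm : m ≤ n) (hN : N ≤ n)
    (Wd : PMF (Fin n → Bool)) (hW : IsAlphaSource n Wd α m N hm hN) (hk : ℓ * m < N)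
    (i : Fin ℓ) : α ≤ avgCondMinEntropy (samplesDist Wd m (by simpa using hm) i) := by
  refine le_trans hW (avgCondMinEntropy_le_of_guessProb_le ?_)
  have hm' : m ≤ Fintype.card (Fin n) := by simpa using hm
  have hN' : N ≤ Fintype.card (Fin n) := by simpa using hN
  have := mSub_nonempty hm'
  let V := {A : Finset (Fin n) // A.card = m}
  let G : Finset (Fin n) → Finset (Fin n) → ENNReal := fun a C =>
    guessProb (Wd.map fun w => (subsample w a, subsample w C))
  have hG (a) : Monotone (G a) := by
    intro C D h
    simp only [G, subsample_of_subset _ h]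
    exact guessProb_map_le Wd (fun w => subsample w a) id (fun w => subsample w D)
      fun y i => if i ∈ C then y i else none
  have hsource : guessProb (do
      let w ← Wd
      let A ← uniformSubset (Fin n) m hm'
      let B ← uniformSubset (Fin n) N hN'
      return (subsample w A.1, (subsample w B.1, A, B))) =
      ∑ a : V, ∑ B : {A : Finset (Fin n) // A.card = N},
        (Fintype.card V : ENNReal)⁻¹ *
          ((Fintype.card {A : Finset (Fin n) // A.card = N} : ENNReal)⁻¹ * G a.1 B.1) := by
    have := guessProb_bind_public
      (pmfProd (uniformSubset (Fin n) m hm') (uniformSubset (Fin n) N hN')) Wd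
      (fun P w => subsample w P.1.1) (fun P w => subsample w P.2.1)
    rw [Fintype.sum_prod_type] at this
    simp only [pmfProd, PMF.bind_bind, PMF.map, Function.comp_def, PMF.pure_bind] at this
    refine Eq.trans (congrArg guessProb ?_) (this.trans ?_)
    · refine (PMF.bind_comm _ _ _).trans ?_
      exact congrArg (PMF.bind _) (funext fun A => PMF.bind_comm _ _ _)
    · refine Finset.sum_congr rfl fun A _ => Finset.sum_congr rfl fun B _ => ?_
      have hp := pmfProd_apply (uniformSubset (Fin n) m hm') (uniformSubset (Fin n) N hN') A B
      rw [uniformSubset_apply, uniformSubset_apply] at hp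
      simp only [pmfProd, PMF.map, Function.comp_def] at hp
      rw [hp, mul_assoc]
      rfl
  have hsamples (A : Fin ℓ → V) :
      guessProb (Wd.map fun w => (sampleBits w (A i), fun j : {j // j ≠ i} => sampleBits w (A j))) ≤
        G (A i).1 (Finset.univ.biUnion fun j : {j // j ≠ i} => (A j).1) := by
    have hsub (j : {j // j ≠ i}) :
        (A j).1 ⊆ Finset.univ.biUnion fun j : {j // j ≠ i} => (A j).1 :=
      Finset.subset_biUnion_of_mem (fun j : {j // j ≠ i} => (A j).1) (Finset.mem_univ j)
    refine le_trans (le_of_eq ?_) ((guessProb_map_le Wd (fun w => sampleBits w (A i))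
      (fun x l => if h : l ∈ (A i).1 then
        some (x (((A i).1.orderIsoOfFin (A i).2).symm ⟨l, h⟩)) else none)
      (fun w => subsample w (Finset.univ.biUnion fun j : {j // j ≠ i} => (A j).1))
      fun y (j : {j // j ≠ i}) l => (y ((A j).1.orderIsoOfFin (A j).2 l).1).getD false).trans_eq ?_)
    · exact congrArg (fun f => guessProb (Wd.map f)) (funext fun w =>
        Prod.ext rfl (funext fun j => sampleBits_eq_of_subset w (A j) (hsub j)))
    · exact congrArg (fun f => guessProb (Wd.map f)) (funext fun w =>
        Prod.ext (subsample_eq_sampleBits w (A i)).symm rfl)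
  have hcard : Fintype.card {j // j ≠ i} * m ≤ N :=
    (Nat.mul_le_mul_right m ((Fintype.card_subtype_le _).trans_eq (Fintype.card_fin ℓ))).trans hk.le
  refine le_of_le_of_eq ?_ hsource.symm
  rw [samplesDist, guessProb_bind_public (uniformSubsets (Fin n) m ℓ hm') Wd]
  calc _ ≤ ∑ A : Fin ℓ → V, (Fintype.card (Fin ℓ → V) : ENNReal)⁻¹ *
        G (A i).1 (Finset.univ.biUnion fun j : {j // j ≠ i} => (A j).1) := by
        gcongr with A
        · exact (uniformSubsets_apply _ _).le
        · exact hsamples A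
    _ = ∑ a : V, (Fintype.card V : ENNReal)⁻¹ *
        ((Fintype.card ({j // j ≠ i} → V) : ENNReal)⁻¹ * ∑ c : {j // j ≠ i} → V,
          G a.1 (Finset.univ.biUnion fun j => (c j).1)) := by
        simp only [Finset.mul_sum]
        rw [← Fintype.sum_prod_type', ← Equiv.sum_comp (Equiv.funSplitAt i V)]
        refine Finset.sum_congr rfl fun A _ => ?_
        rw [Fintype.card_congr (Equiv.funSplitAt i V), Fintype.card_prod, Nat.cast_mul,
          ENNReal.mul_inv (Or.inl (natCast_card_ne_zero _)) (Or.inl (ENNReal.natCast_ne_top _)),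
          mul_assoc]
        rfl
    _ ≤ ∑ a : V, (Fintype.card V : ENNReal)⁻¹ *
        ((Fintype.card {A : Finset (Fin n) // A.card = N} : ENNReal)⁻¹ *
          ∑ B : {A : Finset (Fin n) // A.card = N}, G a.1 B.1) := by
        refine Finset.sum_le_sum fun a _ => mul_le_mul_right ?_ _
        exact average_biUnion_le hm' hN' hcard (hG a.1)
    _ = _ := by simp only [Finset.mul_sum]

/-- Random samples of a random string after extraction, with the extracted strings indexed by `T`
replaced by independent uniform strings. -/
def hybridDist {n m r ν ℓ : ℕ} (Wd : PMF (Fin n → Bool)) (hm : m ≤ Fintype.card (Fin n))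
    (E : (Fin m → Bool) → (Fin r → Bool) → (Fin ν → Bool)) (T : Finset (Fin ℓ)) :
    PMF ((Fin ℓ → Fin ν → Bool) × (Fin r → Bool) ×
      (Fin ℓ → {A : Finset (Fin n) // A.card = m})) :=
  Wd.bind fun w => (PMF.uniformOfFintype (Fin r → Bool)).bind fun Z =>
    (uniformSubsets (Fin n) m ℓ hm).bind fun A =>
      (PMF.uniformOfFintype (Fin ℓ → Fin ν → Bool)).bind fun u =>
        PMF.pure (fun j => if j ∈ T then u j else E (sampleBits w (A j)) Z, Z, A)

theorem statDist_hybridDist_insert_le {n m N r ν ℓ : ℕ} {α ε : ℝ} (hm : m ≤ n) (hN : N ≤ n)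
    (Wd : PMF (Fin n → Bool)) (hW : IsAlphaSource n Wd α m N hm hN)
    (E : (Fin m → Bool) → (Fin r → Bool) → (Fin ν → Bool)) (hE : IsAvgExtractor E α ε)
    (hk : ℓ * m < N) (hm' : m ≤ Fintype.card (Fin n)) {i : Fin ℓ} {T : Finset (Fin ℓ)}
    (hi : i ∉ T) :
    statDist (hybridDist Wd hm' E T) (hybridDist Wd hm' E (insert i T)) ≤ ε := by
  let V := {A : Finset (Fin n) // A.card = m}
  let κ : (Fin ν → Bool) × (({j : Fin ℓ // j ≠ i} → Fin m → Bool) × (Fin ℓ → V)) × (Fin r → Bool) →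
      PMF ((Fin ℓ → Fin ν → Bool) × (Fin r → Bool) × (Fin ℓ → V)) := fun z =>
    (PMF.uniformOfFintype (Fin ℓ → Fin ν → Bool)).bind fun u =>
      PMF.pure (fun j => if j ∈ T then u j else
        if h : j ≠ i then E (z.2.1.1 ⟨j, h⟩) z.2.2 else z.1, z.2.2, z.2.1.2)
  have hext := hE _ _ (le_avgCondMinEntropy_samplesDist hm hN Wd hW hk i)
  refine le_trans (le_of_eq_of_le ?_ (statDist_bind_le _ _ κ)) hext
  congr 1
  · simp only [hybridDist, samplesDist, pmfProd, PMF.map, PMF.bind_bind, PMF.pure_bind,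
      Function.comp_def, κ]
    rw [PMF.bind_comm (uniformSubsets (Fin n) m ℓ hm')]
    refine congrArg (PMF.bind _) (funext fun w => ?_)
    rw [PMF.bind_comm]
    refine congrArg (PMF.bind _) (funext fun A => congrArg (PMF.bind _) (funext fun Z =>
      congrArg (PMF.bind _) (funext fun u => congrArg PMF.pure (Prod.ext (funext fun j => ?_) rfl))))
    by_cases h : j = i
    · subst h; simp
    · simp [h]
  · simp only [hybridDist, samplesDist, pmfProd, PMF.map, PMF.bind_bind, PMF.pure_bind,
      Function.comp_def, κ]
    rw [PMF.bind_comm (uniformSubsets (Fin n) m ℓ hm')]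
    refine congrArg (PMF.bind _) (funext fun w => ?_)
    rw [PMF.bind_comm]
    refine congrArg (PMF.bind _) (funext fun A => congrArg (PMF.bind _) (funext fun Z => ?_))
    rw [← uniformOfFintype_bind_update i]
    refine congrArg (PMF.bind _) (funext fun y => congrArg (PMF.bind _) (funext fun u =>
      congrArg PMF.pure (Prod.ext (funext fun j => ?_) rfl)))
    by_cases h : j = i
    · subst h; simp [hi]
    · simp [h]

theorem statDist_hybridDist_empty_le {n m N r ν ℓ : ℕ} {α ε : ℝ} (hm : m ≤ n) (hN : N ≤ n)
    (Wd : PMF (Fin n → Bool)) (hW : IsAlphaSource n Wd α m N hm hN)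
    (E : (Fin m → Bool) → (Fin r → Bool) → (Fin ν → Bool)) (hE : IsAvgExtractor E α ε)
    (hk : ℓ * m < N) (hm' : m ≤ Fintype.card (Fin n)) (T : Finset (Fin ℓ)) :
    statDist (hybridDist Wd hm' E ∅) (hybridDist Wd hm' E T) ≤ T.card * ε := by
  induction T using Finset.induction_on with
  | empty => simp [statDist_self]
  | insert i T hi ih =>
    have h := statDist_hybridDist_insert_le hm hN Wd hW E hE hk hm' hi
    have h' := statDist_triangle (hybridDist Wd hm' E ∅) (hybridDist Wd hm' E T)
      (hybridDist Wd hm' E (insert i T))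
    rw [Finset.card_insert_of_notMem hi]
    push_cast
    linarith

theorem uniformOfFintype_bind_equiv {α β : Type*} [Fintype α] [Nonempty α]
    (e : α ≃ α) (F : α → PMF β) :
    ((PMF.uniformOfFintype α).bind fun a => F (e a)) = (PMF.uniformOfFintype α).bind F := by
  conv_rhs => rw [← uniformOfFintype_map_equiv e, PMF.bind_map]
  rfl

/-- Masking with `b` is a bijection of the tuples of bit strings. -/
def xorMask (ι : Type*) {κ : Type*} (b : κ → Bool) : Equiv.Perm (ι → κ → Bool) :=
  Function.Involutive.toPerm (fun u i j => Bool.xor (u i j) (b j)) fun u => by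
    funext i j
    simp

/-- With `W` an `(α,m,N)`-source, `E` an average case `(m,α,ν,ε)`-extractor
(with the uniform-to-uniform property), `ν = t + s`, `Z` a uniform seed, `A_1,…,A_ℓ`
independent uniformly random `m`-subsets, `S` uniform over `{0,1}^{ν−t}` and independent of
everything else, and `p_i = E(W[A_i], Z) ⊕ (0^t | S)`: if `ℓ·m < N` then
`Δ((S, p_1,…,p_ℓ, Z, A_1,…,A_ℓ); (U, p_1,…,p_ℓ, Z, A_1,…,A_ℓ)) ≤ 2ℓ·ε`. -/
theorem one_time_pad_subsamples_hides_S
    (n m N t s r ℓ : ℕ) (α ε : ℝ) (hm : m ≤ n) (hN : N ≤ n)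
    (Wd : PMF (Fin n → Bool)) (hW : IsAlphaSource n Wd α m N hm hN)
    (E : (Fin m → Bool) → (Fin r → Bool) → (Fin (t + s) → Bool))
    (hE : IsAvgExtractor E α ε)
    (hEunif :
      (pmfProd (PMF.uniformOfFintype (Fin m → Bool))
          (PMF.uniformOfFintype (Fin r → Bool))).map (fun z => E z.1 z.2) =
        PMF.uniformOfFintype (Fin (t + s) → Bool))
    (hk : ℓ * m < N) :
    statDist
      (do
        let w ← Wd
        let Z ← PMF.uniformOfFintype (Fin r → Bool)
        let A ← uniformSubsets (Fin n) m ℓ (by simpa using hm)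
        let S ← PMF.uniformOfFintype (Fin s → Bool)
        return (S,
          (fun i j => Bool.xor (E (sampleBits w (A i)) Z j)
            (Fin.append (fun _ : Fin t => false) S j)),
          Z, A))
      (do
        let w ← Wd
        let Z ← PMF.uniformOfFintype (Fin r → Bool)
        let A ← uniformSubsets (Fin n) m ℓ (by simpa using hm)
        let S ← PMF.uniformOfFintype (Fin s → Bool)
        let U ← PMF.uniformOfFintype (Fin s → Bool)
        return (U,
          (fun i j => Bool.xor (E (sampleBits w (A i)) Z j)
            (Fin.append (fun _ : Fin t => false) S j)),
          Z, A))
      ≤ 2 * ℓ * ε := by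
  have hm' : m ≤ Fintype.card (Fin n) := by simpa using hm
  let V := {A : Finset (Fin n) // A.card = m}
  let Q := (Fin ℓ → Fin (t + s) → Bool) × (Fin r → Bool) × (Fin ℓ → V)
  let R := (Fin s → Bool) × (Fin ℓ → Fin (t + s) → Bool) × (Fin r → Bool) × (Fin ℓ → V)
  let pad : (Fin s → Bool) → Fin (t + s) → Bool := Fin.append fun _ : Fin t => false
  let κ : Q → PMF R := fun z => (PMF.uniformOfFintype (Fin s → Bool)).bind fun S =>
    PMF.pure (S, xorMask (Fin ℓ) (pad S) z.1, z.2)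
  let κ' : Q → PMF R := fun z => (PMF.uniformOfFintype (Fin s → Bool)).bind fun S =>
    (PMF.uniformOfFintype (Fin s → Bool)).bind fun U =>
      PMF.pure (U, xorMask (Fin ℓ) (pad S) z.1, z.2)
  have hreal : (hybridDist Wd hm' E ∅).bind κ = Wd.bind fun w =>
      (PMF.uniformOfFintype (Fin r → Bool)).bind fun Z =>
      (uniformSubsets (Fin n) m ℓ hm').bind fun A =>
      (PMF.uniformOfFintype (Fin s → Bool)).bind fun S => PMF.pure
        (S, (fun i j => Bool.xor (E (sampleBits w (A i)) Z j) (pad S j)), Z, A) := by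
    simp only [hybridDist, PMF.bind_bind, PMF.pure_bind, κ, Finset.notMem_empty, if_false,
      PMF.bind_const]
    rfl
  have hideal : (hybridDist Wd hm' E ∅).bind κ' = Wd.bind fun w =>
      (PMF.uniformOfFintype (Fin r → Bool)).bind fun Z =>
      (uniformSubsets (Fin n) m ℓ hm').bind fun A =>
      (PMF.uniformOfFintype (Fin s → Bool)).bind fun S =>
      (PMF.uniformOfFintype (Fin s → Bool)).bind fun U => PMF.pure
        (U, (fun i j => Bool.xor (E (sampleBits w (A i)) Z j) (pad S j)), Z, A) := by
    simp only [hybridDist, PMF.bind_bind, PMF.pure_bind, κ', Finset.notMem_empty, if_false,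
      PMF.bind_const]
    rfl
  have huniv : (hybridDist Wd hm' E Finset.univ).bind κ =
      (hybridDist Wd hm' E Finset.univ).bind κ' := by
    simp only [hybridDist, PMF.bind_bind, PMF.pure_bind, κ, κ', Finset.mem_univ, if_true]
    refine congrArg (PMF.bind _) (funext fun w => congrArg (PMF.bind _) (funext fun Z =>
      congrArg (PMF.bind _) (funext fun A => ?_)))
    rw [PMF.bind_comm, PMF.bind_comm (PMF.uniformOfFintype (Fin ℓ → Fin (t + s) → Bool))]
    have hκ (S : Fin s → Bool) :
        ((PMF.uniformOfFintype (Fin ℓ → Fin (t + s) → Bool)).bind fun u =>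
          (PMF.uniformOfFintype (Fin s → Bool)).bind fun U =>
            PMF.pure ((U, xorMask (Fin ℓ) (pad S) u, Z, A) : R)) =
        (PMF.uniformOfFintype (Fin ℓ → Fin (t + s) → Bool)).bind fun u =>
          (PMF.uniformOfFintype (Fin s → Bool)).bind fun U => PMF.pure ((U, u, Z, A) : R) :=
      uniformOfFintype_bind_equiv (xorMask (Fin ℓ) (pad S)) fun u =>
        (PMF.uniformOfFintype (Fin s → Bool)).bind fun U => PMF.pure ((U, u, Z, A) : R)
    have hκ₀ (S : Fin s → Bool) :
        ((PMF.uniformOfFintype (Fin ℓ → Fin (t + s) → Bool)).bind fun u =>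
            PMF.pure ((S, xorMask (Fin ℓ) (pad S) u, Z, A) : R)) =
        (PMF.uniformOfFintype (Fin ℓ → Fin (t + s) → Bool)).bind fun u =>
          PMF.pure ((S, u, Z, A) : R) :=
      uniformOfFintype_bind_equiv (xorMask (Fin ℓ) (pad S)) fun u => PMF.pure ((S, u, Z, A) : R)
    simp only [hκ, hκ₀, PMF.bind_const]
    exact PMF.bind_comm _ _ _
  have hhyb := statDist_hybridDist_empty_le hm hN Wd hW E hE hk hm' Finset.univ
  rw [Finset.card_univ, Fintype.card_fin] at hhyb
  calc _ = statDist ((hybridDist Wd hm' E ∅).bind κ) ((hybridDist Wd hm' E ∅).bind κ') := by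
        rw [hreal, hideal]
        rfl
    _ ≤ statDist ((hybridDist Wd hm' E ∅).bind κ) ((hybridDist Wd hm' E Finset.univ).bind κ) +
        statDist ((hybridDist Wd hm' E Finset.univ).bind κ) ((hybridDist Wd hm' E ∅).bind κ') :=
        statDist_triangle _ _ _
    _ ≤ ℓ * ε + ℓ * ε := by
        refine add_le_add ((statDist_bind_le _ _ κ).trans hhyb) ?_
        rw [huniv, statDist_comm]
        exact (statDist_bind_le _ _ κ').trans hhyb
    _ = 2 * ℓ * ε := by ring

end
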